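/- The restriction of the projection π to the center Z(U_q(f_m(K))) = C[Ω] is an injective algebra homomorphism into U_q(F, K^{±1}); i.e., if u = Σ_{i=0}^{N} u_i Ω^i with u_N ≠ 0 then π(u) ≠ 0. -/

import Mathlib

noncomputable section

inductive UqGen : Type
  | E : UqGen
  | F : UqGen
  | K : UqGen
  | Kinv : UqGen

def lpow {A : Type*} [Monoid A] (x xinv : A) (n : ℤ) : A :=
  if 0 ≤ n then x ^ n.toNat else xinv ^ (-n).toNat

open FreeAlgebra in
inductive UqRel (q : ℂ) (m : ℕ) : FreeAlgebra ℂ UqGen → FreeAlgebra ℂ UqGen → Prop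
  | KE : UqRel q m (ι ℂ UqGen.K * ι ℂ UqGen.E) (q ^ 2 • (ι ℂ UqGen.E * ι ℂ UqGen.K))
  | KF : UqRel q m (ι ℂ UqGen.K * ι ℂ UqGen.F) ((q ^ 2)⁻¹ • (ι ℂ UqGen.F * ι ℂ UqGen.K))
  | KKinv : UqRel q m (ι ℂ UqGen.K * ι ℂ UqGen.Kinv) 1
  | KinvK : UqRel q m (ι ℂ UqGen.Kinv * ι ℂ UqGen.K) 1
  | EF : UqRel q m (ι ℂ UqGen.E * ι ℂ UqGen.F - ι ℂ UqGen.F * ι ℂ UqGen.E)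
      ((q - q⁻¹)⁻¹ • ((ι ℂ UqGen.K) ^ m - (ι ℂ UqGen.Kinv) ^ m))

abbrev Uq (q : ℂ) (m : ℕ) : Type := RingQuot (UqRel q m)

def Egen (q : ℂ) (m : ℕ) : Uq q m := RingQuot.mkAlgHom ℂ (UqRel q m) (FreeAlgebra.ι ℂ UqGen.E)
def Fgen (q : ℂ) (m : ℕ) : Uq q m := RingQuot.mkAlgHom ℂ (UqRel q m) (FreeAlgebra.ι ℂ UqGen.F)
def Kgen (q : ℂ) (m : ℕ) : Uq q m := RingQuot.mkAlgHom ℂ (UqRel q m) (FreeAlgebra.ι ℂ UqGen.K)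
def Kinvgen (q : ℂ) (m : ℕ) : Uq q m := RingQuot.mkAlgHom ℂ (UqRel q m) (FreeAlgebra.ι ℂ UqGen.Kinv)

def Kzpow (q : ℂ) (m : ℕ) (n : ℤ) : Uq q m := lpow (Kgen q m) (Kinvgen q m) n

def Casimir (q : ℂ) (m : ℕ) : Uq q m :=
  Fgen q m * Egen q m +
    (((q ^ (2 * m) - 1) * (q - q⁻¹))⁻¹ * q ^ (2 * m)) • Kgen q m ^ m +
    ((q ^ (2 * m) - 1) * (q - q⁻¹))⁻¹ • Kinvgen q m ^ m


/-! ### The universal Whittaker module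

The space with basis `F ^ i * K ^ j * w` (`i : ℕ`, `j : ℤ`), where `E * w = e • w`. -/

namespace Whittaker

abbrev Mod : Type := (ℕ × ℤ) →₀ ℂ

def actF : Module.End ℂ Mod :=
  Finsupp.linearCombination ℂ fun p => Finsupp.single (p.1 + 1, p.2) 1

def actK (q : ℂ) : Module.End ℂ Mod :=
  Finsupp.linearCombination ℂ fun p => Finsupp.single (p.1, p.2 + 1) ((q ^ 2)⁻¹ ^ p.1)

def actKinv (q : ℂ) : Module.End ℂ Mod :=
  Finsupp.linearCombination ℂ fun p => Finsupp.single (p.1, p.2 - 1) ((q ^ 2) ^ p.1)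

def coeff (q : ℂ) (m : ℕ) (x : ℂ) (i : ℕ) : ℂ :=
  (q - q⁻¹)⁻¹ * ∑ s ∈ Finset.range i, (x ^ s) ^ m

def actE (q : ℂ) (m : ℕ) (e : ℂ) : Module.End ℂ Mod :=
  Finsupp.linearCombination ℂ fun p =>
    Finsupp.single p (e * (q ^ 2)⁻¹ ^ p.2) +
    Finsupp.single (p.1 - 1, p.2 + m) (coeff q m (q ^ 2)⁻¹ p.1) -
    Finsupp.single (p.1 - 1, p.2 - m) (coeff q m (q ^ 2) p.1)

lemma coeff_zero (q : ℂ) (m : ℕ) (x : ℂ) : coeff q m x 0 = 0 := by simp [coeff]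

lemma coeff_succ (q : ℂ) (m : ℕ) (x : ℂ) (i : ℕ) :
    coeff q m x (i + 1) = coeff q m x i + (q - q⁻¹)⁻¹ * (x ^ i) ^ m := by
  simp [coeff, Finset.sum_range_succ, mul_add]

lemma actF_single (i : ℕ) (j : ℤ) (c : ℂ) :
    actF (Finsupp.single (i, j) c) = Finsupp.single (i + 1, j) c := by
  simp [actF]

lemma actK_single (q : ℂ) (i : ℕ) (j : ℤ) (c : ℂ) :
    actK q (Finsupp.single (i, j) c) = Finsupp.single (i, j + 1) (c * (q ^ 2)⁻¹ ^ i) := by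
  simp [actK]

lemma actKinv_single (q : ℂ) (i : ℕ) (j : ℤ) (c : ℂ) :
    actKinv q (Finsupp.single (i, j) c) = Finsupp.single (i, j - 1) (c * (q ^ 2) ^ i) := by
  simp [actKinv]

lemma actE_single (q : ℂ) (m : ℕ) (e : ℂ) (i : ℕ) (j : ℤ) (c : ℂ) :
    actE q m e (Finsupp.single (i, j) c) =
      Finsupp.single (i, j) (c * (e * (q ^ 2)⁻¹ ^ j)) +
      Finsupp.single (i - 1, j + m) (c * coeff q m (q ^ 2)⁻¹ i) -
      Finsupp.single (i - 1, j - m) (c * coeff q m (q ^ 2) i) := by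
  simp only [actE, Finsupp.linearCombination_single, smul_sub, smul_add, Finsupp.smul_single,
    smul_eq_mul]

lemma actK_pow_single (q : ℂ) (n i : ℕ) (j : ℤ) (c : ℂ) :
    (actK q ^ n) (Finsupp.single (i, j) c) =
      Finsupp.single (i, j + n) (c * ((q ^ 2)⁻¹ ^ i) ^ n) := by
  induction n with
  | zero => simp
  | succ n ih =>
    rw [pow_succ', Module.End.mul_apply, ih, actK_single, mul_assoc, ← pow_succ]
    simp only [Nat.cast_succ, add_assoc]

lemma actKinv_pow_single (q : ℂ) (n i : ℕ) (j : ℤ) (c : ℂ) :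
    (actKinv q ^ n) (Finsupp.single (i, j) c) =
      Finsupp.single (i, j - n) (c * ((q ^ 2) ^ i) ^ n) := by
  induction n with
  | zero => simp
  | succ n ih =>
    rw [pow_succ', Module.End.mul_apply, ih, actKinv_single, mul_assoc, ← pow_succ]
    simp only [Nat.cast_succ, sub_sub]

lemma end_ext {f g : Module.End ℂ Mod}
    (h : ∀ i j, f (Finsupp.single (i, j) 1) = g (Finsupp.single (i, j) 1)) : f = g :=
  Finsupp.lhom_ext' fun p => LinearMap.ext_ring (h p.1 p.2)

lemma actK_actKinv {q : ℂ} (hq0 : q ≠ 0) : actK q * actKinv q = 1 := by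
  refine end_ext fun i j => ?_
  rw [Module.End.mul_apply, actKinv_single, actK_single]
  have : (q ^ 2) ^ i ≠ 0 := by positivity
  simp [hq0]

lemma actKinv_actK {q : ℂ} (hq0 : q ≠ 0) : actKinv q * actK q = 1 := by
  refine end_ext fun i j => ?_
  rw [Module.End.mul_apply, actK_single, actKinv_single]
  simp [hq0]

lemma actK_actF (q : ℂ) : actK q * actF = (q ^ 2)⁻¹ • (actF * actK q) := by
  refine end_ext fun i j => ?_
  simp only [Module.End.mul_apply, LinearMap.smul_apply, actK_single, actF_single,
    Finsupp.smul_single, smul_eq_mul]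
  congr 1
  ring

lemma actK_actE {q : ℂ} (hq0 : q ≠ 0) (m : ℕ) (e : ℂ) :
    actK q * actE q m e = q ^ 2 • (actE q m e * actK q) := by
  refine end_ext fun i j => ?_
  have hq2 : (q ^ 2)⁻¹ ≠ 0 := inv_ne_zero (pow_ne_zero 2 hq0)
  simp only [Module.End.mul_apply, LinearMap.smul_apply, actK_single, actE_single, map_add,
    map_sub, smul_add, smul_sub, Finsupp.smul_single, smul_eq_mul, zpow_add_one₀ hq2]
  cases i with
  | zero =>
    simp only [coeff_zero, mul_zero, zero_mul, Finsupp.single_zero, add_zero, sub_zero]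
    congr 1
    field_simp
  | succ i =>
    simp only [Nat.add_sub_cancel, add_right_comm j, sub_add_eq_add_sub j]
    have h : q ^ 2 * (q ^ 2)⁻¹ = 1 := mul_inv_cancel₀ (pow_ne_zero 2 hq0)
    congr 2
    · congr 1
      linear_combination (-(e * (q ^ 2)⁻¹ ^ j * (q ^ 2)⁻¹ ^ (i + 1))) * h
    · congr 1
      linear_combination (-(coeff q m (q ^ 2)⁻¹ (i + 1) * (q ^ 2)⁻¹ ^ i)) * h
    · linear_combination (-(coeff q m (q ^ 2) (i + 1) * (q ^ 2)⁻¹ ^ i)) * h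

lemma actE_actF (q : ℂ) (m : ℕ) (e : ℂ) :
    actE q m e * actF - actF * actE q m e =
      (q - q⁻¹)⁻¹ • (actK q ^ m - actKinv q ^ m) := by
  refine end_ext fun i j => ?_
  simp only [Module.End.mul_apply, LinearMap.smul_apply, LinearMap.sub_apply, actF_single,
    actE_single, map_add, map_sub, actK_pow_single, actKinv_pow_single, coeff_succ,
    Nat.add_sub_cancel, smul_sub, Finsupp.smul_single, smul_eq_mul, one_mul]
  cases i with
  | zero =>
    simp only [coeff_zero, zero_add, Finsupp.single_zero, add_zero, sub_zero]
    abel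
  | succ i => simp only [Nat.add_sub_cancel, Finsupp.single_add]; abel

def genAct (q : ℂ) (m : ℕ) (e : ℂ) : UqGen → Module.End ℂ Mod
  | .E => actE q m e
  | .F => actF
  | .K => actK q
  | .Kinv => actKinv q

def rep {q : ℂ} (hq0 : q ≠ 0) (m : ℕ) (e : ℂ) : Uq q m →ₐ[ℂ] Module.End ℂ Mod :=
  RingQuot.liftAlgHom ℂ ⟨FreeAlgebra.lift ℂ (genAct q m e), by
    intro x y h
    cases h with
    | KE => simpa [genAct] using actK_actE hq0 m e
    | KF => simpa [genAct] using actK_actF q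
    | KKinv => simpa [genAct] using actK_actKinv hq0
    | KinvK => simpa [genAct] using actKinv_actK hq0
    | EF => simpa [genAct] using actE_actF q m e⟩

section rep

variable {q : ℂ} (hq0 : q ≠ 0) (m : ℕ) (e : ℂ)

@[simp] lemma rep_E : rep hq0 m e (Egen q m) = actE q m e := by
  simp [rep, Egen, genAct]

@[simp] lemma rep_F : rep hq0 m e (Fgen q m) = actF := by
  simp [rep, Fgen, genAct]

@[simp] lemma rep_K : rep hq0 m e (Kgen q m) = actK q := by
  simp [rep, Kgen, genAct]

@[simp] lemma rep_Kinv : rep hq0 m e (Kinvgen q m) = actKinv q := by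
  simp [rep, Kinvgen, genAct]

end rep

def cyclicVec : Mod := Finsupp.single (0, 0) 1

lemma actE_cyclicVec (q : ℂ) (m : ℕ) (e : ℂ) : actE q m e cyclicVec = e • cyclicVec := by
  simp [cyclicVec, actE_single, coeff_zero]

end Whittaker

/-! ### Relations and spanning sets in `Uq` -/

section Relations

variable (q : ℂ) (m : ℕ)

lemma Kgen_mul_Kinvgen : Kgen q m * Kinvgen q m = 1 := by
  simpa [Kgen, Kinvgen] using RingQuot.mkAlgHom_rel ℂ (UqRel.KKinv (q := q) (m := m))

lemma Kinvgen_mul_Kgen : Kinvgen q m * Kgen q m = 1 := by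
  simpa [Kgen, Kinvgen] using RingQuot.mkAlgHom_rel ℂ (UqRel.KinvK (q := q) (m := m))

lemma Kgen_mul_Egen : Kgen q m * Egen q m = q ^ 2 • (Egen q m * Kgen q m) := by
  simpa [Kgen, Egen] using RingQuot.mkAlgHom_rel ℂ (UqRel.KE (q := q) (m := m))

lemma Kgen_mul_Fgen : Kgen q m * Fgen q m = (q ^ 2)⁻¹ • (Fgen q m * Kgen q m) := by
  simpa [Kgen, Fgen] using RingQuot.mkAlgHom_rel ℂ (UqRel.KF (q := q) (m := m))

lemma Egen_mul_Fgen : Egen q m * Fgen q m = Fgen q m * Egen q m +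
    (q - q⁻¹)⁻¹ • (Kgen q m ^ m - Kinvgen q m ^ m) := by
  have := RingQuot.mkAlgHom_rel ℂ (UqRel.EF (q := q) (m := m))
  simp only [map_sub, map_mul, map_smul, map_pow] at this
  exact sub_eq_iff_eq_add'.1 this

def Kunit : (Uq q m)ˣ :=
  ⟨Kgen q m, Kinvgen q m, Kgen_mul_Kinvgen q m, Kinvgen_mul_Kgen q m⟩

@[simp] lemma val_Kunit : (Kunit q m : Uq q m) = Kgen q m := rfl

@[simp] lemma val_inv_Kunit : ((Kunit q m)⁻¹ : (Uq q m)ˣ) = Kinvgen q m := rfl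

/-- Conjugation by `K`. -/
def conjK : Uq q m →ₐ[ℂ] Uq q m where
  toFun u := Kgen q m * u * Kinvgen q m
  map_one' := by simp [Kgen_mul_Kinvgen]
  map_mul' u v := by
    have h := Kinvgen_mul_Kgen q m
    calc Kgen q m * (u * v) * Kinvgen q m
        = Kgen q m * u * 1 * v * Kinvgen q m := by noncomm_ring
      _ = _ := by rw [← h]; noncomm_ring
  map_zero' := by simp
  map_add' u v := by simp [mul_add, add_mul]
  commutes' r := by
    rw [← Algebra.commutes, mul_assoc, Kgen_mul_Kinvgen, mul_one]

lemma conjK_apply (u : Uq q m) : conjK q m u = Kgen q m * u * Kinvgen q m := rfl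

lemma conjK_Egen : conjK q m (Egen q m) = q ^ 2 • Egen q m := by
  rw [conjK_apply, Kgen_mul_Egen, smul_mul_assoc, mul_assoc, Kgen_mul_Kinvgen, mul_one]

lemma conjK_Fgen : conjK q m (Fgen q m) = (q ^ 2)⁻¹ • Fgen q m := by
  rw [conjK_apply, Kgen_mul_Fgen, smul_mul_assoc, mul_assoc, Kgen_mul_Kinvgen, mul_one]

lemma conjK_Kunit_zpow (j : ℤ) :
    conjK q m ((Kunit q m ^ j : (Uq q m)ˣ) : Uq q m) = (Kunit q m ^ j : (Uq q m)ˣ) := by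
  rw [conjK_apply, ← val_Kunit, ← val_inv_Kunit, ← Units.val_mul, ← Units.val_mul]
  congr 1
  group

/-- The monomial `F ^ i * K ^ j`. -/
def monFK (p : ℕ × ℤ) : Uq q m := Fgen q m ^ p.1 * (Kunit q m ^ p.2 : (Uq q m)ˣ)

def subalgFK : Subalgebra ℂ (Uq q m) :=
  Algebra.adjoin ℂ {Fgen q m, Kgen q m, Kinvgen q m}

lemma Fgen_mem_subalgFK : Fgen q m ∈ subalgFK q m := Algebra.subset_adjoin (by simp)

lemma Kgen_mem_subalgFK : Kgen q m ∈ subalgFK q m := Algebra.subset_adjoin (by simp)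

lemma Kinvgen_mem_subalgFK : Kinvgen q m ∈ subalgFK q m := Algebra.subset_adjoin (by simp)

variable {q m}

lemma conjK_monFK (p : ℕ × ℤ) :
    conjK q m (monFK q m p) = (q ^ 2)⁻¹ ^ p.1 • monFK q m p := by
  rw [monFK, map_mul, map_pow, conjK_Fgen, conjK_Kunit_zpow, smul_pow, smul_mul_assoc]

lemma Kgen_mul_eq (u : Uq q m) : Kgen q m * u = conjK q m u * Kgen q m := by
  rw [conjK_apply, mul_assoc _ (Kinvgen q m), Kinvgen_mul_Kgen, mul_one]

lemma monFK_mul_Kgen (i : ℕ) (j : ℤ) :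
    monFK q m (i, j) * Kgen q m = monFK q m (i, j + 1) := by
  rw [monFK, monFK, mul_assoc, ← val_Kunit, ← Units.val_mul, zpow_add_one]

lemma Kgen_mul_monFK (i : ℕ) (j : ℤ) :
    Kgen q m * monFK q m (i, j) = (q ^ 2)⁻¹ ^ i • monFK q m (i, j + 1) := by
  rw [Kgen_mul_eq, conjK_monFK, smul_mul_assoc, monFK_mul_Kgen]

lemma Kinvgen_mul_monFK (hq0 : q ≠ 0) (i : ℕ) (j : ℤ) :
    Kinvgen q m * monFK q m (i, j) = (q ^ 2) ^ i • monFK q m (i, j - 1) := by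
  have h := Kgen_mul_monFK (q := q) (m := m) i (j - 1)
  rw [sub_add_cancel] at h
  calc Kinvgen q m * monFK q m (i, j)
      = (q ^ 2) ^ i • (Kinvgen q m * ((q ^ 2)⁻¹ ^ i • monFK q m (i, j))) := by
        rw [mul_smul_comm, smul_smul, inv_pow, mul_inv_cancel₀ (by positivity), one_smul]
    _ = _ := by rw [← h, ← mul_assoc, Kinvgen_mul_Kgen, one_mul]

lemma mem_span_of_mul_mem {R A : Type*} [CommSemiring R] [Semiring A] [Algebra R A]
    {s : Set A} {N : Submodule R A} (h1 : 1 ∈ N)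
    (hs : ∀ a ∈ s, ∀ x ∈ N, a * x ∈ N) {u : A} (hu : u ∈ Algebra.adjoin R s) : u ∈ N := by
  suffices h : ∀ x ∈ N, u * x ∈ N by simpa using h 1 h1
  induction hu using Algebra.adjoin_induction with
  | mem a ha => exact hs a ha
  | algebraMap r => intro x hx; rw [← Algebra.smul_def]; exact N.smul_mem r hx
  | add a b _ _ iha ihb => intro x hx; rw [add_mul]; exact N.add_mem (iha x hx) (ihb x hx)
  | mul a b _ _ iha ihb => intro x hx; rw [mul_assoc]; exact iha _ (ihb x hx)

lemma mul_mem_span_of_forall {R A : Type*} [CommSemiring R] [Semiring A] [Algebra R A]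
    {s : Set A} {N : Submodule R A} {a : A} (h : ∀ x ∈ s, a * x ∈ N) :
    ∀ x ∈ Submodule.span R s, a * x ∈ N :=
  Submodule.span_le (p := N.comap (LinearMap.mulLeft R a)).2 h

lemma mem_span_of_mem_subalgFK (hq0 : q ≠ 0) {u : Uq q m} (hu : u ∈ subalgFK q m) :
    u ∈ Submodule.span ℂ (Set.range (monFK q m)) := by
  refine mem_span_of_mul_mem (Submodule.subset_span (Set.mem_range.2 ⟨(0, 0), by simp [monFK]⟩))
    ?_ hu
  rintro a ha
  refine mul_mem_span_of_forall ?_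
  rintro _ ⟨⟨i, j⟩, rfl⟩
  have hmem (p) : monFK q m p ∈ Submodule.span ℂ (Set.range (monFK q m)) :=
    Submodule.subset_span ⟨p, rfl⟩
  rcases ha with rfl | rfl | rfl
  · have : Fgen q m * monFK q m (i, j) = monFK q m (i + 1, j) := by
      simp only [monFK, pow_succ', mul_assoc]
    exact this ▸ hmem _
  · rw [Kgen_mul_monFK]
    exact Submodule.smul_mem _ _ (hmem _)
  · rw [Kinvgen_mul_monFK hq0]
    exact Submodule.smul_mem _ _ (hmem _)

lemma Egen_mul_subalgFK (hq0 : q ≠ 0) {a : Uq q m} (ha : a ∈ subalgFK q m) :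
    ∃ b ∈ subalgFK q m, ∃ c ∈ subalgFK q m, Egen q m * a = b * Egen q m + c := by
  induction ha using Algebra.adjoin_induction with
  | mem a ha =>
    rcases ha with rfl | rfl | rfl
    · exact ⟨_, Fgen_mem_subalgFK q m, _, (subalgFK q m).smul_mem
        (sub_mem (pow_mem (Kgen_mem_subalgFK q m) m) (pow_mem (Kinvgen_mem_subalgFK q m) m)) _,
        Egen_mul_Fgen q m⟩
    · refine ⟨_, (subalgFK q m).smul_mem (Kgen_mem_subalgFK q m) (q ^ 2)⁻¹, 0, zero_mem _, ?_⟩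
      rw [smul_mul_assoc, Kgen_mul_Egen, smul_smul, inv_mul_cancel₀ (by positivity), one_smul,
        add_zero]
    · refine ⟨_, (subalgFK q m).smul_mem (Kinvgen_mem_subalgFK q m) (q ^ 2), 0, zero_mem _, ?_⟩
      calc Egen q m * Kinvgen q m
          = Kinvgen q m * (Kgen q m * Egen q m) * Kinvgen q m := by
            rw [← mul_assoc (Kinvgen q m), Kinvgen_mul_Kgen, one_mul]
        _ = q ^ 2 • (Kinvgen q m * Egen q m * (Kgen q m * Kinvgen q m)) := by
            rw [Kgen_mul_Egen]; simp only [mul_smul_comm, smul_mul_assoc, mul_assoc]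
        _ = _ := by rw [Kgen_mul_Kinvgen, mul_one, smul_mul_assoc, add_zero]
  | algebraMap r =>
    exact ⟨_, (subalgFK q m).algebraMap_mem r, 0, zero_mem _, by
      rw [add_zero, Algebra.commutes]⟩
  | add a a' _ _ iha iha' =>
    obtain ⟨b, hb, c, hc, h⟩ := iha
    obtain ⟨b', hb', c', hc', h'⟩ := iha'
    exact ⟨_, add_mem hb hb', _, add_mem hc hc', by rw [mul_add, h, h', add_mul]; abel⟩
  | mul a a' _ ha' iha iha' =>
    obtain ⟨b, hb, c, hc, h⟩ := iha
    obtain ⟨b', hb', c', hc', h'⟩ := iha'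
    refine ⟨_, mul_mem hb hb', _, add_mem (mul_mem hb hc') (mul_mem hc ha'), ?_⟩
    rw [← mul_assoc, h, add_mul, mul_assoc b, h', mul_add]
    noncomm_ring

lemma adjoin_gens_eq_top :
    Algebra.adjoin ℂ {Egen q m, Fgen q m, Kgen q m, Kinvgen q m} = ⊤ := by
  refine eq_top_iff.2 fun u _ => ?_
  obtain ⟨x, rfl⟩ := RingQuot.mkAlgHom_surjective ℂ (UqRel q m) u
  induction x using FreeAlgebra.induction with
  | grade0 r => rw [AlgHom.commutes]; exact Subalgebra.algebraMap_mem _ r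
  | grade1 g => cases g <;> exact Algebra.subset_adjoin (by simp [Egen, Fgen, Kgen, Kinvgen])
  | mul a b ha hb => rw [map_mul]; exact mul_mem (ha trivial) (hb trivial)
  | add a b ha hb => rw [map_add]; exact add_mem (ha trivial) (hb trivial)

/-- The monomial `F ^ i * K ^ j * E ^ l`. -/
def monFKE (q : ℂ) (m : ℕ) (p : ℕ × ℤ) (l : ℕ) : Uq q m := monFK q m p * Egen q m ^ l

lemma mul_Egen_pow_mem_span (hq0 : q ≠ 0) {a : Uq q m} (ha : a ∈ subalgFK q m) (l : ℕ) :
    a * Egen q m ^ l ∈ Submodule.span ℂ (Set.range (Function.uncurry (monFKE q m))) := by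
  replace ha := mem_span_of_mem_subalgFK hq0 ha
  induction ha using Submodule.span_induction with
  | mem x hx =>
    obtain ⟨p, rfl⟩ := hx
    exact Submodule.subset_span ⟨(p, l), rfl⟩
  | zero => simp
  | add x y _ _ hx hy => rw [add_mul]; exact add_mem hx hy
  | smul c x _ hx => rw [smul_mul_assoc]; exact Submodule.smul_mem _ _ hx

lemma monFK_mem_subalgFK (p : ℕ × ℤ) : monFK q m p ∈ subalgFK q m := by
  refine mul_mem (pow_mem (Fgen_mem_subalgFK q m) _) ?_
  obtain ⟨n, h | h⟩ := p.2.eq_nat_or_neg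
  · rw [h, zpow_natCast, Units.val_pow_eq_pow_val]
    exact pow_mem (Kgen_mem_subalgFK q m) _
  · rw [h, zpow_neg, zpow_natCast, ← inv_pow, Units.val_pow_eq_pow_val]
    exact pow_mem (Kinvgen_mem_subalgFK q m) _

lemma span_monFKE (hq0 : q ≠ 0) :
    Submodule.span ℂ (Set.range (Function.uncurry (monFKE q m))) = ⊤ := by
  refine eq_top_iff.2 fun u _ => ?_
  have hu : u ∈ Algebra.adjoin ℂ {Egen q m, Fgen q m, Kgen q m, Kinvgen q m} :=
    adjoin_gens_eq_top (q := q) (m := m) ▸ trivial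
  refine mem_span_of_mul_mem (Submodule.subset_span
    (Set.mem_range.2 ⟨((0, 0), 0), by simp [monFKE, monFK]⟩)) ?_ hu
  intro a ha
  refine mul_mem_span_of_forall ?_
  rintro _ ⟨⟨p, l⟩, rfl⟩
  have hp := monFK_mem_subalgFK (q := q) (m := m) p
  change a * (monFK q m p * Egen q m ^ l) ∈ _
  rw [← mul_assoc]
  rcases ha with rfl | ha
  · obtain ⟨b, hb, c, hc, h⟩ := Egen_mul_subalgFK hq0 hp
    rw [h, add_mul, mul_assoc, ← pow_succ']
    exact add_mem (mul_Egen_pow_mem_span hq0 hb _) (mul_Egen_pow_mem_span hq0 hc _)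
  · exact mul_Egen_pow_mem_span hq0 (mul_mem (Algebra.subset_adjoin ha) hp) _

lemma conjK_monFKE (p : ℕ × ℤ) (l : ℕ) :
    conjK q m (monFKE q m p l) = ((q ^ 2)⁻¹ ^ p.1 * (q ^ 2) ^ l) • monFKE q m p l := by
  rw [monFKE, map_mul, conjK_monFK, map_pow, conjK_Egen, smul_pow, smul_mul_smul_comm]

lemma weight_ne_one (hq0 : q ≠ 0) (hq : ∀ k : ℕ, 0 < k → q ^ k ≠ 1) {i l : ℕ} (h : i ≠ l) :
    (q ^ 2)⁻¹ ^ i * (q ^ 2) ^ l ≠ 1 := by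
  intro h1
  have h2 : (q ^ 2) ^ l = (q ^ 2) ^ i := by
    rw [inv_pow] at h1
    field_simp at h1
    simpa [← pow_mul] using h1
  rcases lt_or_gt_of_ne h with h | h
  · obtain ⟨k, rfl⟩ := Nat.exists_eq_add_of_lt h
    refine hq (2 * (k + 1)) (by omega) ?_
    rw [add_assoc, pow_add] at h2
    rw [pow_mul]
    exact (mul_eq_left₀ (by positivity)).1 h2
  · obtain ⟨k, rfl⟩ := Nat.exists_eq_add_of_lt h
    refine hq (2 * (k + 1)) (by omega) ?_
    rw [add_assoc, pow_add] at h2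
    rw [pow_mul]
    exact (mul_eq_left₀ (by positivity)).1 h2.symm

/-- An element commuting with `K` is a combination of the monomials `F ^ i * K ^ j * E ^ i`. -/
lemma mem_span_diag_of_commute (hq0 : q ≠ 0) (hq : ∀ k : ℕ, 0 < k → q ^ k ≠ 1) {u : Uq q m}
    (hu : Kgen q m * u = u * Kgen q m) :
    u ∈ Submodule.span ℂ (Set.range fun p : ℕ × ℤ => monFKE q m p p.1) := by
  let f : Module.End ℂ (Uq q m) := (conjK q m).toLinearMap
  let D := Submodule.span ℂ (Set.range fun p : ℕ × ℤ => monFKE q m p p.1)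
  let R := ⨆ μ, ⨆ (_ : μ ≠ (1 : ℂ)), f.eigenspace μ
  have hmem (p : ℕ × ℤ) (l : ℕ) :
      monFKE q m p l ∈ f.eigenspace ((q ^ 2)⁻¹ ^ p.1 * (q ^ 2) ^ l) :=
    Module.End.mem_eigenspace_iff.2 (conjK_monFKE p l)
  have hD : D ≤ f.eigenspace 1 := by
    refine Submodule.span_le.2 ?_
    rintro _ ⟨p, rfl⟩
    have := hmem p p.1
    rwa [← mul_pow, inv_mul_cancel₀ (by positivity), one_pow] at this
  have htop : u ∈ D ⊔ R := by
    have hle : Submodule.span ℂ (Set.range (Function.uncurry (monFKE q m))) ≤ D ⊔ R := by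
      refine Submodule.span_le.2 ?_
      rintro _ ⟨⟨p, l⟩, rfl⟩
      by_cases h : p.1 = l
      · subst h
        exact Submodule.mem_sup_left (Submodule.subset_span ⟨p, rfl⟩)
      · exact Submodule.mem_sup_right
          (Submodule.mem_iSup_of_mem _
          (Submodule.mem_iSup_of_mem (weight_ne_one hq0 hq h) (hmem p l)))
    exact hle (span_monFKE (q := q) (m := m) hq0 ▸ trivial)
  obtain ⟨d, hd, r, hr, rfl⟩ := Submodule.mem_sup.1 htop
  have hu1 : d + r ∈ f.eigenspace 1 := by
    refine Module.End.mem_eigenspace_iff.2 ?_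
    change Kgen q m * (d + r) * Kinvgen q m = _
    rw [hu, mul_assoc, Kgen_mul_Kinvgen, mul_one, one_smul]
  have hr1 : r ∈ f.eigenspace 1 := by simpa using sub_mem hu1 (hD hd)
  have : r = 0 := Submodule.disjoint_def.1 (f.eigenspaces_iSupIndep 1) r hr1 hr
  simpa [this] using hd

end Relations

/-! ### Action on the cyclic vector -/

namespace Whittaker

variable {q : ℂ} (hq0 : q ≠ 0) {m : ℕ} {e : ℂ}

lemma rep_Kunit_zpow_cyclicVec (j : ℤ) :
    rep hq0 m e ((Kunit q m ^ j : (Uq q m)ˣ) : Uq q m) cyclicVec = Finsupp.single (0, j) 1 := by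
  obtain ⟨n, rfl | rfl⟩ := j.eq_nat_or_neg
  · rw [zpow_natCast, Units.val_pow_eq_pow_val, val_Kunit, map_pow, rep_K, cyclicVec,
      actK_pow_single]
    simp
  · rw [zpow_neg, zpow_natCast, ← inv_pow, Units.val_pow_eq_pow_val, val_inv_Kunit, map_pow,
      rep_Kinv, cyclicVec, actKinv_pow_single]
    simp

lemma rep_monFK_cyclicVec (p : ℕ × ℤ) :
    rep hq0 m e (monFK q m p) cyclicVec = Finsupp.single p 1 := by
  obtain ⟨i, j⟩ := p
  rw [monFK, map_mul, Module.End.mul_apply, rep_Kunit_zpow_cyclicVec, map_pow, rep_F]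
  induction i with
  | zero => simp
  | succ i ih => rw [pow_succ', Module.End.mul_apply, ih, actF_single]

lemma rep_monFKE_cyclicVec (p : ℕ × ℤ) (l : ℕ) :
    rep hq0 m e (monFKE q m p l) cyclicVec = e ^ l • Finsupp.single p 1 := by
  have h : (actE q m e ^ l) cyclicVec = e ^ l • cyclicVec := by
    induction l with
    | zero => simp
    | succ l ih =>
      rw [pow_succ, Module.End.mul_apply, actE_cyclicVec, map_smul, ih, smul_smul, pow_succ']
  rw [monFKE, map_mul, Module.End.mul_apply, map_pow, rep_E, h, map_smul, rep_monFK_cyclicVec]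

lemma eq_zero_of_mem_span {y : ℕ × ℤ → Uq q m} {c : ℕ × ℤ → ℂ} (hc : ∀ p, c p ≠ 0)
    (hy : ∀ p, rep hq0 m e (y p) cyclicVec = c p • Finsupp.single p 1) {u : Uq q m}
    (hu : u ∈ Submodule.span ℂ (Set.range y)) (h0 : rep hq0 m e u cyclicVec = 0) : u = 0 := by
  obtain ⟨f, rfl⟩ := Finsupp.mem_span_range_iff_exists_finsupp.1 hu
  have hf : f = 0 := by
    ext p
    have h := DFunLike.congr_fun h0 p
    simp only [Finsupp.sum, map_sum, LinearMap.sum_apply, map_smul, LinearMap.smul_apply, hy,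
      Finsupp.finsetSum_apply, Finsupp.smul_apply, Finsupp.single_apply, smul_eq_mul, mul_ite,
      mul_one, mul_zero, Finset.sum_ite_eq', Finsupp.coe_zero, Pi.zero_apply] at h
    by_contra hp
    rw [if_pos (Finsupp.mem_support_iff.2 hp)] at h
    exact mul_ne_zero hp (hc p) h
  simp [hf]

lemma eq_zero_of_mem_subalgFK {u : Uq q m} (hu : u ∈ subalgFK q m)
    (h0 : rep hq0 m e u cyclicVec = 0) : u = 0 :=
  eq_zero_of_mem_span hq0 (c := 1) (by simp) (by simp [rep_monFK_cyclicVec])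
    (mem_span_of_mem_subalgFK hq0 hu) h0

lemma eq_zero_of_commute_Kgen (hq : ∀ k : ℕ, 0 < k → q ^ k ≠ 1) (he : e ≠ 0) {u : Uq q m}
    (hu : Kgen q m * u = u * Kgen q m) (h0 : rep hq0 m e u cyclicVec = 0) : u = 0 :=
  eq_zero_of_mem_span hq0 (c := fun p => e ^ p.1) (fun _ => pow_ne_zero _ he)
    (fun p => rep_monFKE_cyclicVec hq0 p p.1) (mem_span_diag_of_commute hq0 hq hu) h0

lemma rep_Casimir_single (i : ℕ) (j : ℤ) :
    rep hq0 m e (Casimir q m) (Finsupp.single (i, j) 1) -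
      Finsupp.single (i + 1, j) (e * (q ^ 2)⁻¹ ^ j) ∈
        Finsupp.supported ℂ ℂ {p : ℕ × ℤ | p.1 < i + 1} := by
  have hs (j' : ℤ) (c : ℂ) :
      Finsupp.single (i, j') c ∈ Finsupp.supported ℂ ℂ {p : ℕ × ℤ | p.1 < i + 1} :=
    Finsupp.single_mem_supported ℂ c (by simp)
  have hs' (j' : ℤ) (x : ℂ) : Finsupp.single (i - 1 + 1, j') (coeff q m x i) ∈
      Finsupp.supported ℂ ℂ {p : ℕ × ℤ | p.1 < i + 1} := by
    cases i with
    | zero => simp [coeff_zero]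
    | succ i => exact hs j' _
  simp only [Casimir, map_add, map_mul, map_smul, map_pow, rep_F, rep_E, rep_K, rep_Kinv,
    LinearMap.add_apply, LinearMap.smul_apply, Module.End.mul_apply, actE_single, map_sub,
    actF_single, actK_pow_single, actKinv_pow_single, one_mul, Finsupp.smul_single]
  rw [show ∀ a b c d f : Mod, a + b - c + d + f - a = b - c + d + f by intros; abel]
  exact add_mem (add_mem (sub_mem (hs' _ _) (hs' _ _)) (hs _ _)) (hs _ _)

lemma rep_Casimir_mem_supported (n : ℕ) {v : Mod}
    (hv : v ∈ Finsupp.supported ℂ ℂ {p : ℕ × ℤ | p.1 < n}) :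
    rep hq0 m e (Casimir q m) v ∈ Finsupp.supported ℂ ℂ {p : ℕ × ℤ | p.1 < n + 1} := by
  rw [Finsupp.supported_eq_span_single] at hv
  refine Submodule.span_le
    (p := (Finsupp.supported ℂ ℂ {p : ℕ × ℤ | p.1 < n + 1}).comap (rep hq0 m e (Casimir q m)))
    |>.2 ?_ hv
  rintro _ ⟨⟨i, j⟩, hi, rfl⟩
  have hi : i < n := hi
  have h := Finsupp.supported_mono (R := ℂ) (M := ℂ)
    (show {p : ℕ × ℤ | p.1 < i + 1} ⊆ {p | p.1 < n + 1} from fun _ hp => by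
      simp only [Set.mem_ofPred_eq] at hp ⊢; omega)
    (rep_Casimir_single hq0 (m := m) (e := e) i j)
  have h' : Finsupp.single (i + 1, j) (e * (q ^ 2)⁻¹ ^ j) ∈
      Finsupp.supported ℂ ℂ {p : ℕ × ℤ | p.1 < n + 1} :=
    Finsupp.single_mem_supported ℂ _ (by simpa using hi)
  simpa using add_mem h h'

lemma rep_Casimir_pow_cyclicVec (n : ℕ) :
    rep hq0 m e (Casimir q m ^ n) cyclicVec - Finsupp.single (n, 0) (e ^ n) ∈
      Finsupp.supported ℂ ℂ {p : ℕ × ℤ | p.1 < n} := by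
  induction n with
  | zero => simp [cyclicVec]
  | succ n ih =>
    have h1 := rep_Casimir_mem_supported hq0 (m := m) (e := e) n ih
    have h2 := Submodule.smul_mem _ (e ^ n) (rep_Casimir_single hq0 (m := m) (e := e) n 0)
    rw [map_sub] at h1
    convert add_mem h1 h2 using 1
    rw [smul_sub, ← map_smul, Finsupp.smul_single, Finsupp.smul_single, smul_eq_mul, mul_one,
      zpow_zero, mul_one, smul_eq_mul, ← pow_succ, pow_succ', map_mul, Module.End.mul_apply]
    abel

lemma rep_sum_Casimir_ne_zero (he : e ≠ 0) (N : ℕ) (c : ℕ → ℂ) (hN : c N ≠ 0) :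
    rep hq0 m e (∑ i ∈ Finset.range (N + 1), c i • Casimir q m ^ i) cyclicVec ≠ 0 := by
  intro h
  have key (i : ℕ) (hi : i ≤ N) :
      rep hq0 m e (Casimir q m ^ i) cyclicVec (N, 0) = if i = N then e ^ N else 0 := by
    have h := (Finsupp.mem_supported' ℂ _).1
      (rep_Casimir_pow_cyclicVec hq0 (m := m) (e := e) i) (N, 0) (by simpa using hi)
    rw [Finsupp.sub_apply, sub_eq_zero, Finsupp.single_apply] at h
    rw [h]
    by_cases hiN : i = N <;> simp [hiN]
  have h' := DFunLike.congr_fun h (N, 0)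
  rw [map_sum, LinearMap.sum_apply, Finsupp.finsetSum_apply, Finset.sum_eq_single N] at h'
  · rw [map_smul, LinearMap.smul_apply, Finsupp.smul_apply, key N le_rfl] at h'
    simp [hN, he] at h'
  · intro i hi hiN
    rw [map_smul, LinearMap.smul_apply, Finsupp.smul_apply,
      key i (Nat.lt_succ_iff.1 (Finset.mem_range.1 hi)), if_neg hiN, smul_zero]
  · simp

lemma rep_adjoin_Egen_cyclicVec (η : Algebra.adjoin ℂ ({Egen q m} : Set (Uq q m)) →ₐ[ℂ] ℂ)
    (he : η ⟨Egen q m, Algebra.subset_adjoin (Set.mem_singleton _)⟩ = e)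
    (x : Algebra.adjoin ℂ ({Egen q m} : Set (Uq q m))) :
    rep hq0 m e (x : Uq q m) cyclicVec = η x • cyclicVec := by
  obtain ⟨x, hx⟩ := x
  induction hx using Algebra.adjoin_induction with
  | mem x hx =>
    obtain rfl := Set.mem_singleton_iff.1 hx
    rw [he, rep_E, actE_cyclicVec]
  | algebraMap r =>
    have : η (algebraMap ℂ _ r) = r := η.commutes r
    rw [AlgHom.commutes, Module.algebraMap_end_apply]
    exact congrArg (· • cyclicVec) this.symm
  | add a b ha hb iha ihb =>
    have : η (⟨a, ha⟩ + ⟨b, hb⟩) = _ := map_add η _ _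
    rw [map_add, LinearMap.add_apply, iha, ihb, ← add_smul, ← this]
    rfl
  | mul a b ha hb iha ihb =>
    have : η (⟨a, ha⟩ * ⟨b, hb⟩) = _ := map_mul η _ _
    rw [map_mul, Module.End.mul_apply, ihb, map_smul, iha, smul_smul, mul_comm, ← this]
    rfl

lemma rep_cyclicVec_eq_zero_of_mem
    (η : Algebra.adjoin ℂ ({Egen q m} : Set (Uq q m)) →ₐ[ℂ] ℂ)
    (he : η ⟨Egen q m, Algebra.subset_adjoin (Set.mem_singleton _)⟩ = e) {u : Uq q m}
    (hu : u ∈ Submodule.span ℂ {z : Uq q m |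
        ∃ (w : Uq q m) (x : ↥(Algebra.adjoin ℂ ({Egen q m} : Set (Uq q m)))),
          η x = 0 ∧ z = w * (x : Uq q m)}) :
    rep hq0 m e u cyclicVec = 0 := by
  induction hu using Submodule.span_induction with
  | mem z hz =>
    obtain ⟨w, x, hx, rfl⟩ := hz
    rw [map_mul, Module.End.mul_apply, rep_adjoin_Egen_cyclicVec hq0 η he, hx, zero_smul, map_zero]
  | zero => simp
  | add x y _ _ hx hy => rw [map_add, LinearMap.add_apply, hx, hy, add_zero]
  | smul c x _ hx => rw [map_smul, LinearMap.smul_apply, hx, smul_zero]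

end Whittaker

/-- The restriction of the projection `π` to the center
`Z(U_q(f_m(K))) = ℂ[Ω]` is an injective algebra homomorphism into `U_q(F, K^{±1})`;
in particular if `u = ∑_{i=0}^{N} u_i Ω^i` with `u_N ≠ 0` then `π(u) ≠ 0`. -/
theorem stmt12 (q : ℂ) (m : ℕ) (hm : 1 ≤ m) (hq0 : q ≠ 0)
    (hq : ∀ k : ℕ, 0 < k → q ^ k ≠ 1)
    (η : ↥(Algebra.adjoin ℂ ({Egen q m} : Set (Uq q m))) →ₐ[ℂ] ℂ)
    (hη : η ⟨Egen q m, Algebra.subset_adjoin (Set.mem_singleton _)⟩ ≠ 0)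
    (π : Uq q m →ₗ[ℂ] Uq q m)
    (hπ1 : ∀ u : Uq q m,
      π u ∈ Algebra.adjoin ℂ ({Fgen q m, Kgen q m, Kinvgen q m} : Set (Uq q m)))
    (hπ2 : ∀ u : Uq q m,
      u - π u ∈ Submodule.span ℂ {z : Uq q m |
        ∃ (w : Uq q m) (x : ↥(Algebra.adjoin ℂ ({Egen q m} : Set (Uq q m)))),
          η x = 0 ∧ z = w * (x : Uq q m)}) :
    (∀ u v : Uq q m, u ∈ Subalgebra.center ℂ (Uq q m) →
        v ∈ Subalgebra.center ℂ (Uq q m) → π (u * v) = π u * π v) ∧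
    (∀ N : ℕ, ∀ c : ℕ → ℂ, c N ≠ 0 →
        π (∑ i ∈ Finset.range (N + 1), c i • Casimir q m ^ i) ≠ 0) ∧
    Set.InjOn π (Subalgebra.center ℂ (Uq q m) : Set (Uq q m)) := by
  set e := η ⟨Egen q m, Algebra.subset_adjoin (Set.mem_singleton _)⟩ with he
  have hρ (u : Uq q m) : Whittaker.rep hq0 m e u Whittaker.cyclicVec =
      Whittaker.rep hq0 m e (π u) Whittaker.cyclicVec := by
    have h := Whittaker.rep_cyclicVec_eq_zero_of_mem hq0 η he.symm (hπ2 u)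
    rwa [map_sub, LinearMap.sub_apply, sub_eq_zero] at h
  have hmul (u v : Uq q m) (hu : u ∈ Subalgebra.center ℂ (Uq q m)) :
      π (u * v) = π v * π u := by
    refine sub_eq_zero.1 (Whittaker.eq_zero_of_mem_subalgFK hq0 (e := e)
      (sub_mem (hπ1 _) (mul_mem (hπ1 _) (hπ1 _))) ?_)
    have huv : u * π v = π v * u := (Subalgebra.mem_center_iff.1 hu (π v)).symm
    rw [map_sub, LinearMap.sub_apply, ← hρ, map_mul, map_mul, Module.End.mul_apply,
      Module.End.mul_apply, hρ v, ← hρ u, ← Module.End.mul_apply, ← Module.End.mul_apply,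
      ← map_mul, ← map_mul, huv, sub_self]
  refine ⟨fun u v hu hv => ?_, fun N c hc h => ?_, fun u hu v hv h => ?_⟩
  · rw [← Subalgebra.mem_center_iff.1 hu v, hmul v u hv]
  · refine Whittaker.rep_sum_Casimir_ne_zero hq0 (m := m) hη N c hc ?_
    rw [hρ, h, map_zero, LinearMap.zero_apply]
  · refine sub_eq_zero.1 (Whittaker.eq_zero_of_commute_Kgen hq0 hq hη
      (Subalgebra.mem_center_iff.1 (sub_mem hu hv) _) ?_)
    rw [hρ, map_sub π, h, sub_self, map_zero, LinearMap.zero_apply]
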